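/- For every positive integer t, the complete graph on 2t vertices can be decomposed into t pairwise edge-disjoint Hamiltonian paths (whose edge sets partition the edge set of the complete graph), and in any such decomposition every vertex is an endpoint of exactly one of the t Hamiltonian paths. -/

import Mathlib

open SimpleGraph Finset Pointwise

/-- A decomposition of the complete graph on `Fin n` into `t` pairwise edge-disjoint
Hamiltonian paths `p i` from `a i` to `b i`, whose edge sets partition the edge set. -/
def IsHamPathDecomposition {n : ℕ} (t : ℕ) (a b : Fin t → Fin n)
    (p : ∀ i, (completeGraph (Fin n)).Walk (a i) (b i)) : Prop :=
  (∀ i, (p i).IsHamiltonian) ∧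
  ∀ e ∈ (completeGraph (Fin n)).edgeSet, ∃! i, e ∈ (p i).edges

namespace SimpleGraph.Walk

variable {V : Type*} {G : SimpleGraph V}

lemma exists_support_eq_map_range (f : ℕ → V) (m : ℕ) (hf : ∀ k < m, G.Adj (f k) (f (k + 1))) :
    ∃ p : G.Walk (f 0) (f m), p.support = (List.range (m + 1)).map f ∧
      p.edges = (List.range m).map fun k => s(f k, f (k + 1)) := by
  induction m with
  | zero => exact ⟨nil, by simp⟩
  | succ m ih =>
    obtain ⟨p, hs, he⟩ := ih fun k hk => hf k (by omega)
    refine ⟨p.concat (hf m (by omega)), ?_, ?_⟩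
    · rw [support_concat, hs, List.range_succ (n := m + 1)]
      simp
    · rw [edges_concat, he, List.range_succ]
      simp

lemma IsHamiltonian.ncard_neighborSet_toSubgraph_add [DecidableEq V] {u v : V} {p : G.Walk u v}
    (hp : p.IsHamiltonian) (hnil : ¬ p.Nil) (w : V) :
    (p.toSubgraph.neighborSet w).ncard + (if w = u ∨ w = v then 1 else 0) = 2 := by
  split_ifs with hw
  · rcases hw with rfl | rfl
    · rw [hp.isPath.neighborSet_toSubgraph_startpoint hnil, Set.ncard_singleton]
    · rw [hp.isPath.neighborSet_toSubgraph_endpoint hnil, Set.ncard_singleton]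
  · push Not at hw
    obtain ⟨k, rfl, hk⟩ := mem_support_iff_exists_getVert.mp (hp.mem_support w)
    refine hp.isPath.ncard_neighborSet_toSubgraph_internal_eq_two ?_ (lt_of_le_of_ne hk ?_)
    · rintro rfl
      simp at hw
    · rintro rfl
      simp at hw

end SimpleGraph.Walk

/-- The `k`-th vertex of the zigzag path `i, i + 1, i - 1, i + 2, i - 2, …` modulo `2 * t`. -/
def zigzag (t i k : ℕ) : ℕ :=
  if k % 2 = 1 then i + (k + 1) / 2 else if k / 2 ≤ i then i - k / 2 else i + 2 * t - k / 2

lemma zigzag_lt {t i k : ℕ} (hi : i < t) (hk : k < 2 * t) : zigzag t i k < 2 * t := by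
  grind [zigzag]

lemma zigzag_inj {t i k l : ℕ} (hi : i < t) (hk : k < 2 * t) (hl : l < 2 * t)
    (h : zigzag t i k = zigzag t i l) : k = l := by
  unfold zigzag at h
  split_ifs at h <;> omega

lemma exists_zigzag_eq {t i x : ℕ} (hi : i < t) (hx : x < 2 * t) :
    ∃ k < 2 * t, zigzag t i k = x := by
  by_cases h₁ : x ≤ i
  · refine ⟨2 * (i - x), by omega, ?_⟩
    unfold zigzag
    split_ifs <;> omega
  by_cases h₂ : x ≤ i + t
  · refine ⟨2 * (x - i) - 1, by omega, ?_⟩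
    unfold zigzag
    split_ifs <;> omega
  · refine ⟨2 * (i + 2 * t - x), by omega, ?_⟩
    unfold zigzag
    split_ifs <;> omega

lemma zigzag_add_zigzag_succ {t i k : ℕ} (hk : k + 1 < 2 * t) :
    ∃ r < 2, zigzag t i k + zigzag t i (k + 1) = 2 * i + r ∨
      zigzag t i k + zigzag t i (k + 1) = 2 * i + r + 2 * t := by
  refine ⟨(k + 1) % 2, by omega, ?_⟩
  unfold zigzag
  split_ifs <;> omega

lemma exists_zigzag_edge {t x y : ℕ} (hxy : x < y) (hy : y < 2 * t) :
    ∃ i < t, ∃ k, k + 1 < 2 * t ∧ (zigzag t i k = x ∧ zigzag t i (k + 1) = y ∨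
      zigzag t i k = y ∧ zigzag t i (k + 1) = x) := by
  by_cases h : x + y < 2 * t
  · refine ⟨(x + y) / 2, by omega, y - x - 1, by omega, ?_⟩
    unfold zigzag
    split_ifs <;> omega
  · refine ⟨(x + y - 2 * t) / 2, by omega, x + 2 * t - y - 1, by omega, ?_⟩
    unfold zigzag
    split_ifs <;> omega

lemma exists_isHamPathDecomposition {t : ℕ} (ht : 0 < t) :
    ∃ (a b : Fin t → Fin (2 * t)) (p : ∀ i, (completeGraph (Fin (2 * t))).Walk (a i) (b i)),
      IsHamPathDecomposition t a b p := by
  let f (i : Fin t) (k : ℕ) : Fin (2 * t) := ⟨zigzag t i k % (2 * t), Nat.mod_lt _ (by omega)⟩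
  have hf (i : Fin t) {k : ℕ} (hk : k < 2 * t) : (f i k : ℕ) = zigzag t i k :=
    Nat.mod_eq_of_lt (zigzag_lt i.2 hk)
  have hinj (i : Fin t) {k l : ℕ} (hk : k < 2 * t) (hl : l < 2 * t) (h : f i k = f i l) :
      k = l := by
    refine zigzag_inj i.2 hk hl ?_
    rw [← hf i hk, ← hf i hl, h]
  have hadj (i : Fin t) : ∀ k < 2 * t - 1,
      (completeGraph (Fin (2 * t))).Adj (f i k) (f i (k + 1)) := by
    intro k hk h
    have := hinj i (by omega) (by omega) h
    omega
  choose p hsupp hedges using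
    fun i => Walk.exists_support_eq_map_range (f i) (2 * t - 1) (hadj i)
  refine ⟨_, _, p, fun i => ?_, fun e he => ?_⟩
  · have hpath : (p i).IsPath := by
      refine Walk.IsPath.mk' ?_
      rw [hsupp]
      refine List.nodup_range.map_on fun k hk l hl h => ?_
      rw [List.mem_range] at hk hl
      exact hinj i (by omega) (by omega) h
    refine hpath.isHamiltonian_of_mem fun x => ?_
    obtain ⟨k, hk, hx⟩ := exists_zigzag_eq i.2 x.2
    rw [hsupp, List.mem_map]
    exact ⟨k, List.mem_range.mpr (by omega), Fin.ext ((hf i hk).trans hx)⟩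
  · refine existsUnique_of_exists_of_unique ?_ fun i j hi hj => ?_
    · induction e with | _ x y
      wlog hxy : x < y generalizing x y
      · have hne : x ≠ y := he
        rw [Sym2.eq_swap]
        exact this y x (Ne.symm hne) (by omega)
      obtain ⟨i, hi, k, hk, h⟩ := exists_zigzag_edge hxy y.2
      refine ⟨⟨i, hi⟩, ?_⟩
      rw [hedges, List.mem_map]
      refine ⟨k, List.mem_range.mpr (by omega), ?_⟩
      have h₁ := hf ⟨i, hi⟩ (k := k) (by omega)
      have h₂ := hf ⟨i, hi⟩ hk
      simp only [Sym2.eq_iff, Fin.ext_iff, h₁, h₂]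
      exact h
    · rw [hedges, List.mem_map] at hi hj
      obtain ⟨k, hk, rfl⟩ := hi
      obtain ⟨l, hl, h⟩ := hj
      rw [List.mem_range] at hk hl
      obtain ⟨r, hr, hir⟩ := zigzag_add_zigzag_succ (i := i) (show k + 1 < 2 * t by omega)
      obtain ⟨s, hs, hjs⟩ := zigzag_add_zigzag_succ (i := j) (show l + 1 < 2 * t by omega)
      rw [Sym2.eq_iff, Fin.ext_iff, Fin.ext_iff, Fin.ext_iff, Fin.ext_iff,
        hf i (by omega), hf i (by omega), hf j (by omega), hf j (by omega)] at h
      omega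

lemma IsHamPathDecomposition.existsUnique_endpoint {t : ℕ} {a b : Fin t → Fin (2 * t)}
    {p : ∀ i, (completeGraph (Fin (2 * t))).Walk (a i) (b i)}
    (h : IsHamPathDecomposition t a b p) (v : Fin (2 * t)) : ∃! i, v = a i ∨ v = b i := by
  have hnil (i : Fin t) : ¬ (p i).Nil := by
    rw [Walk.not_nil_iff_lt_length, (h.1 i).length_eq, Fintype.card_fin]
    have := i.2
    omega
  have hunion : ({v}ᶜ : Set (Fin (2 * t))) = ⋃ i, (p i).toSubgraph.neighborSet v := by
    ext w
    simp only [Set.mem_compl_iff, Set.mem_singleton_iff, Set.mem_iUnion, Subgraph.mem_neighborSet]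
    refine ⟨fun hw => ?_, fun ⟨i, hi⟩ => ((p i).toSubgraph.adj_sub hi).ne'⟩
    obtain ⟨i, hi, -⟩ := h.2 s(v, w) (Ne.symm hw)
    exact ⟨i, Walk.adj_toSubgraph_iff_mem_edges.mpr hi⟩
  have hdisj : Pairwise (Function.onFun Disjoint fun i => (p i).toSubgraph.neighborSet v) := by
    intro i j hij
    refine Set.disjoint_left.mpr fun w hi hj => hij ?_
    exact (h.2 s(v, w) ((p i).toSubgraph.adj_sub hi)).unique (Walk.adj_toSubgraph_iff_mem_edges.mp hi)
      (Walk.adj_toSubgraph_iff_mem_edges.mp hj)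
  have hdeg : ∑ i, ((p i).toSubgraph.neighborSet v).ncard = 2 * t - 1 := by
    rw [← finsum_eq_sum_of_fintype, ← Set.ncard_iUnion_of_finite (fun _ => Set.toFinite _) hdisj,
      ← hunion, Set.ncard_compl, Set.ncard_singleton, Nat.card_fin]
  have hsum := Finset.sum_congr rfl fun i (_ : i ∈ univ) =>
    (h.1 i).ncard_neighborSet_toSubgraph_add (hnil i) v
  rw [sum_add_distrib, hdeg, ← card_filter, sum_const, card_univ, Fintype.card_fin,
    smul_eq_mul] at hsum
  have hcard : #{i | v = a i ∨ v = b i} = 1 := by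
    have := v.2
    omega
  obtain ⟨i, hi⟩ := card_eq_one.mp hcard
  refine ⟨i, ?_, fun j hj => ?_⟩
  · simpa using hi.ge (mem_singleton_self i)
  · exact mem_singleton.mp (hi.le (mem_filter.mpr ⟨mem_univ j, hj⟩))

/-- For every positive integer `t`, the complete graph on `2t` vertices can
be decomposed into `t` pairwise edge-disjoint Hamiltonian paths, and in any such decomposition
every vertex is an endpoint of exactly one of the `t` Hamiltonian paths. -/
theorem completeGraph_even_hamPathDecomposition (t : ℕ) (ht : 0 < t) :
    (∃ (a b : Fin t → Fin (2 * t))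
        (p : ∀ i, (completeGraph (Fin (2 * t))).Walk (a i) (b i)),
        IsHamPathDecomposition t a b p) ∧
    ∀ (a b : Fin t → Fin (2 * t))
        (p : ∀ i, (completeGraph (Fin (2 * t))).Walk (a i) (b i)),
      IsHamPathDecomposition t a b p →
        ∀ v : Fin (2 * t), ∃! i, v = a i ∨ v = b i := by
  exact ⟨exists_isHamPathDecomposition ht, fun _ _ _ h => h.existsUnique_endpoint⟩
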